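/- arXiv:1710.10413 — 4 statements merged into one kernel-verified Lean document; each statement's English description precedes it below -/
import Mathlib

section
/- For each nonzero integer m, the map Φ_m : e^H_{+,0} → e^H_{+,0} defined by Φ_m(f) = f^m (pointwise m-th power, where negative powers mean pointwise powers of the reciprocal 1/f) is a bijective homeomorphism of e^H_{+,0} onto itself. -/
set_option synthInstance.maxHeartbeats 800000

/-- The space `H(ℂ)` of entire functions, as a subalgebra of `C(ℂ, ℂ)` (the latter
carrying the compact-open topology, i.e. the topology of uniform convergence on
compact subsets of `ℂ`). -/
noncomputable def Entire : Subalgebra ℂ C(ℂ, ℂ) where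
  carrier := {f | Differentiable ℂ ⇑f}
  mul_mem' := fun hf hg => hf.mul hg
  add_mem' := fun hf hg => hf.add hg
  one_mem' := by
    show Differentiable ℂ ⇑(1 : C(ℂ, ℂ))
    have h : ⇑(1 : C(ℂ, ℂ)) = fun _ : ℂ => (1 : ℂ) := rfl
    rw [h]; exact differentiable_const 1
  zero_mem' := by
    show Differentiable ℂ ⇑(0 : C(ℂ, ℂ))
    have h : ⇑(0 : C(ℂ, ℂ)) = fun _ : ℂ => (0 : ℂ) := rfl
    rw [h]; exact differentiable_const 0
  algebraMap_mem' := fun c => by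
    show Differentiable ℂ ⇑((algebraMap ℂ C(ℂ, ℂ)) c)
    have h : ⇑((algebraMap ℂ C(ℂ, ℂ)) c) = fun _ : ℂ => c := by
      ext a; simp [algebraMap_apply]
    rw [h]; exact differentiable_const c

/-- `e^H_{+,0}`: the set of non-vanishing entire functions whose value at `0`
is a positive real number, as a subset of `H(ℂ)`. -/
def expHPlusZero : Set ↥Entire :=
  {f | (∀ z : ℂ, (f : C(ℂ, ℂ)) z ≠ 0) ∧ ((f : C(ℂ, ℂ)) 0).im = 0 ∧ 0 < ((f : C(ℂ, ℂ)) 0).re}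

open Filter Topology Metric

theorem Complex.eq_ofReal_of_im_eq_zero {w : ℂ} (h : w.im = 0 ∧ 0 < w.re) :
    ∃ r : ℝ, 0 < r ∧ w = r :=
  ⟨w.re, h.2, Complex.ext rfl h.1⟩

theorem Complex.finite_setOf_zpow_eq_one {m : ℤ} (hm : m ≠ 0) : {w : ℂ | w ^ m = 1}.Finite := by
  refine (Polynomial.nthRootsFinset m.natAbs (1 : ℂ)).finite_toSet.subset fun w hw => ?_
  rw [Finset.mem_coe, Polynomial.mem_nthRootsFinset (Int.natAbs_pos.2 hm)]
  have hw' : w ^ m = 1 := hw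
  rcases Int.natAbs_eq m with h | h <;> rw [h] at hw'
  · rwa [zpow_natCast] at hw'
  · rwa [zpow_neg, zpow_natCast, inv_eq_one] at hw'

theorem Complex.ofReal_eq_one_of_zpow_eq_one {m : ℤ} (hm : m ≠ 0) {r : ℝ} (hr : 0 < r)
    (h : (r : ℂ) ^ m = 1) : r = 1 :=
  (zpow_left_inj₀ hr.le zero_le_one hm).1 (by rw [one_zpow]; exact_mod_cast h)

/-- Two continuous functions on a preconnected set with the same `m`-th powers agree,
provided both are positive at one point and the second does not vanish. -/
theorem IsPreconnected.eqOn_of_zpow_eq {X : Type*} [TopologicalSpace X] {m : ℤ} (hm : m ≠ 0)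
    {s : Set X} (hs : IsPreconnected s) {x₀ : X} (hx₀ : x₀ ∈ s) {f g : X → ℂ}
    (hf : ContinuousOn f s) (hg : ContinuousOn g s) (hg0 : ∀ x ∈ s, g x ≠ 0)
    (h : ∀ x ∈ s, f x ^ m = g x ^ m) (hf₀ : ∃ r : ℝ, 0 < r ∧ f x₀ = r)
    (hg₀ : ∃ r : ℝ, 0 < r ∧ g x₀ = r) : Set.EqOn f g s := by
  have hpow : ∀ x ∈ s, (f x / g x) ^ m = 1 := fun x hx => by
    rw [div_zpow, h x hx, div_self (zpow_ne_zero _ (hg0 x hx))]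
  have hone : f x₀ / g x₀ = 1 := by
    obtain ⟨a, ha, hfa⟩ := hf₀
    obtain ⟨b, hb, hgb⟩ := hg₀
    have hab := hpow x₀ hx₀
    rw [hfa, hgb, ← Complex.ofReal_div] at hab ⊢
    rw [Complex.ofReal_eq_one_of_zpow_eq_one hm (div_pos ha hb) hab, Complex.ofReal_one]
  have hsub := (Complex.finite_setOf_zpow_eq_one hm).countable.isTotallyDisconnected _
    (Set.image_subset_iff.2 hpow) (hs.image _ (hf.div hg hg0))
  intro x hx
  have hx1 : f x / g x = f x₀ / g x₀ :=
    hsub (Set.mem_image_of_mem _ hx) (Set.mem_image_of_mem _ hx₀)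
  exact (div_eq_one_iff_eq (hg0 x hx)).1 (hx1.trans hone)

theorem Complex.exp_log_div_zpow {m : ℤ} (hm : m ≠ 0) {w : ℂ} (hw : w ≠ 0) :
    Complex.exp (Complex.log w / m) ^ m = w := by
  rw [← Complex.exp_int_mul, mul_div_cancel₀ _ (Int.cast_ne_zero.2 hm), Complex.exp_log hw]

theorem Complex.exp_log_ofReal_div {r : ℝ} (hr : 0 < r) (m : ℤ) :
    ∃ t : ℝ, 0 < t ∧ Complex.exp (Complex.log r / m) = t := by
  refine ⟨Real.exp (Real.log r / m), Real.exp_pos _, ?_⟩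
  rw [← Complex.ofReal_log hr.le]
  push_cast
  rfl

theorem Complex.ofReal_zpow_pos {w : ℂ} (m : ℤ) (hw : ∃ r : ℝ, 0 < r ∧ w = r) :
    ∃ r : ℝ, 0 < r ∧ w ^ m = r := by
  obtain ⟨r, hr, rfl⟩ := hw
  exact ⟨r ^ m, zpow_pos hr m, by push_cast; rfl⟩

theorem Complex.tendsto_one_of_tendsto_zpow {ι : Type*} {l : Filter ι} {m : ℤ} (hm : m ≠ 0)
    {h k : ι → C(ℂ, ℂ)} (hk : ∀ i z, k i z = h i z ^ m) (hpos : ∀ i, ∃ r : ℝ, 0 < r ∧ h i 0 = r)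
    (hlim : Tendsto k l (𝓝 1)) : Tendsto h l (𝓝 1) := by
  rw [ContinuousMap.tendsto_iff_forall_isCompact_tendstoUniformlyOn] at hlim ⊢
  intro K hK
  obtain ⟨R, hR⟩ := hK.isBounded.subset_closedBall 0
  refine TendstoUniformlyOn.mono (s := closedBall 0 (max R 0)) ?_
    (hR.trans (closedBall_subset_closedBall (le_max_left _ _)))
  have hlimB := hlim _ (isCompact_closedBall (0 : ℂ) (max R 0))
  have hcont : ContinuousAt (fun w : ℂ => Complex.exp (Complex.log w / m)) 1 :=
    ((continuousAt_clog Complex.one_mem_slitPlane).div_const _).cexp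
  rw [Metric.tendstoUniformlyOn_iff] at hlimB ⊢
  intro ε hε
  obtain ⟨δ, hδ, hδε⟩ := Metric.continuousAt_iff.1 hcont ε hε
  filter_upwards [hlimB (min δ 1) (lt_min hδ one_pos)] with i hi z hz
  have hnear : ∀ x ∈ closedBall (0 : ℂ) (max R 0), dist (k i x) 1 < min δ 1 := fun x hx => by
    simpa [dist_comm] using hi x hx
  have hslit : ∀ x ∈ closedBall (0 : ℂ) (max R 0), k i x ∈ Complex.slitPlane := fun x hx =>
    Complex.ball_one_subset_slitPlane ((hnear x hx).trans_le (min_le_right _ _))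
  have heq : Set.EqOn (h i) (fun x => Complex.exp (Complex.log (k i x) / m))
      (closedBall 0 (max R 0)) := by
    refine (convex_closedBall (0 : ℂ) _).isPreconnected.eqOn_of_zpow_eq hm
      (mem_closedBall_self (le_max_right _ _)) (h i).continuous.continuousOn
      (((k i).continuous.continuousOn.clog hslit).div_const _).cexp
      (fun _ _ => Complex.exp_ne_zero _) (fun x hx => ?_) (hpos i) ?_
    · rw [Complex.exp_log_div_zpow hm (Complex.slitPlane_ne_zero (hslit x hx)), hk]
    · obtain ⟨r, hr, hkr⟩ := Complex.ofReal_zpow_pos m (hpos i)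
      rw [hk, hkr]
      exact Complex.exp_log_ofReal_div hr m
  have := hδε ((hnear z hz).trans_le (min_le_left _ _))
  rw [heq hz, dist_comm]
  simpa using this

/-- A non-vanishing entire function has an entire logarithm, with prescribed value at `0`. -/
theorem Differentiable.exists_eq_exp {f : ℂ → ℂ} (hf : Differentiable ℂ f) (hf0 : ∀ z, f z ≠ 0) :
    ∃ F : ℂ → ℂ, Differentiable ℂ F ∧ F 0 = Complex.log (f 0) ∧ ∀ z, f z = Complex.exp (F z) := by
  have hd : Differentiable ℂ fun z => _root_.deriv f z / f z := hf.deriv.div hf hf0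
  obtain ⟨F, hF0, hF⟩ := hd.isExactOn_univ.with_val_at 0 (Complex.log (f 0))
  have hG : ∀ z, HasDerivAt (fun z => f z * Complex.exp (-F z)) 0 z := fun z => by
    have := (hf z).hasDerivAt.mul (hF z trivial).neg.cexp
    refine this.congr_deriv ?_
    have := hf0 z
    field_simp
    ring
  refine ⟨F, fun z => (hF z trivial).differentiableAt, hF0, fun z => ?_⟩
  have hc := is_const_of_deriv_eq_zero (fun z => (hG z).differentiableAt)
    (fun z => (hG z).deriv) z 0
  simp only [hF0, Complex.exp_neg, Complex.exp_log (hf0 0)] at hc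
  rw [mul_inv_cancel₀ (hf0 0)] at hc
  exact (mul_inv_eq_one₀ (Complex.exp_ne_zero _)).1 hc

namespace expHPlusZero

theorem exists_pos (f : expHPlusZero) : ∃ r : ℝ, 0 < r ∧ f.1.1 0 = r :=
  Complex.eq_ofReal_of_im_eq_zero f.2.2

theorem ext {f g : expHPlusZero} (h : ∀ z, f.1.1 z = g.1.1 z) : f = g :=
  Subtype.ext (Subtype.ext (ContinuousMap.ext h))

/-- Build an element of `e^H_{+,0}` from a plain function. -/
def mk (f : ℂ → ℂ) (hf : Differentiable ℂ f) (hf0 : ∀ z, f z ≠ 0)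
    (hpos : ∃ r : ℝ, 0 < r ∧ f 0 = r) : expHPlusZero :=
  ⟨⟨⟨f, hf.continuous⟩, hf⟩, hf0, by
    obtain ⟨r, hr, h⟩ := hpos
    change (f 0).im = 0 ∧ 0 < (f 0).re
    simpa [h] using hr⟩

/-- The pointwise `m`-th power map `Φ_m`. -/
noncomputable def zpow (m : ℤ) (f : expHPlusZero) : expHPlusZero :=
  mk (fun z => f.1.1 z ^ m)
    (fun z => (f.1.2 z).zpow (Or.inl (f.2.1 z)))
    (fun z => zpow_ne_zero m (f.2.1 z)) (Complex.ofReal_zpow_pos m (exists_pos f))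

theorem continuous_zpow (m : ℤ) : Continuous (zpow m) := by
  let incl : C({w : ℂ // w ≠ 0}, ℂ) := ⟨Subtype.val, continuous_subtype_val⟩
  let pow : C({w : ℂ // w ≠ 0}, ℂ) :=
    ⟨fun w => w.1 ^ m, continuous_subtype_val.zpow₀ m fun w => Or.inl w.2⟩
  let lift : expHPlusZero → C(ℂ, {w : ℂ // w ≠ 0}) := fun f =>
    ⟨fun z => ⟨f.1.1 z, f.2.1 z⟩, f.1.1.continuous.subtype_mk _⟩
  have hlift : Continuous lift :=
    (ContinuousMap.isInducing_postcomp incl IsInducing.subtypeVal).continuous_iff.2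
      (continuous_subtype_val.comp continuous_subtype_val)
  exact (((ContinuousMap.continuous_postcomp pow).comp hlift).subtype_mk _).subtype_mk _

theorem zpow_injective {m : ℤ} (hm : m ≠ 0) : Function.Injective (zpow m) := fun f g h =>
  ext fun z => isPreconnected_univ.eqOn_of_zpow_eq hm (Set.mem_univ 0)
    f.1.1.continuous.continuousOn g.1.1.continuous.continuousOn (fun z _ => g.2.1 z)
    (fun z _ => congrArg (fun f : expHPlusZero => f.1.1 z) h) (exists_pos f) (exists_pos g)
    (Set.mem_univ z)

theorem zpow_surjective {m : ℤ} (hm : m ≠ 0) : Function.Surjective (zpow m) := fun f => by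
  obtain ⟨F, hF, hF0, hfF⟩ := Differentiable.exists_eq_exp f.1.2 f.2.1
  refine ⟨mk (fun z => Complex.exp (F z / m)) (hF.div_const _).cexp
    (fun z => Complex.exp_ne_zero _) ?_, ext fun z => ?_⟩
  · obtain ⟨r, hr, hfr⟩ := exists_pos f
    rw [hF0, show Complex.log _ = Complex.log r from congrArg Complex.log hfr]
    exact Complex.exp_log_ofReal_div hr m
  · change Complex.exp (F z / m) ^ m = _
    rw [← Complex.exp_int_mul, mul_div_cancel₀ _ (Int.cast_ne_zero.2 hm)]
    exact (hfF z).symm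

/-- If the `m`-th powers converge, so do the functions. -/
theorem tendsto_of_tendsto_zpow {ι : Type*} {l : Filter ι} {m : ℤ} (hm : m ≠ 0)
    {g : ι → expHPlusZero} {f : expHPlusZero}
    (h : Tendsto (fun i => zpow m (g i)) l (𝓝 (zpow m f))) : Tendsto g l (𝓝 f) := by
  have hval : Continuous fun f : expHPlusZero => f.1.1 :=
    continuous_subtype_val.comp continuous_subtype_val
  have hind : IsInducing fun f : expHPlusZero => f.1.1 :=
    IsInducing.subtypeVal.comp IsInducing.subtypeVal
  have hinv (f : expHPlusZero) : f.1.1 * (zpow (-1) f).1.1 = 1 := by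
    ext z
    change f.1.1 z * f.1.1 z ^ (-1 : ℤ) = 1
    rw [zpow_neg_one, mul_inv_cancel₀ (f.2.1 z)]
  have hlim : Tendsto (fun i => (zpow m (g i)).1.1 * (zpow (-1) (zpow m f)).1.1) l (𝓝 1) := by
    rw [← hinv (zpow m f)]
    exact ((hval.tendsto _).comp h).mul_const _
  have hone : Tendsto (fun i => (g i).1.1 * (zpow (-1) f).1.1) l (𝓝 1) := by
    refine Complex.tendsto_one_of_tendsto_zpow hm (fun i z => ?_) (fun i => ?_) hlim
    · change (g i).1.1 z ^ m * (f.1.1 z ^ m) ^ (-1 : ℤ) = ((g i).1.1 z * f.1.1 z ^ (-1 : ℤ)) ^ m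
      rw [mul_zpow, zpow_comm]
    · obtain ⟨a, ha, hga⟩ := exists_pos (g i)
      obtain ⟨b, hb, hfb⟩ := exists_pos (zpow (-1) f)
      exact ⟨a * b, mul_pos ha hb, by rw [ContinuousMap.mul_apply, hga, hfb]; push_cast; rfl⟩
  rw [hind.tendsto_nhds_iff]
  have hmul := hone.mul_const f.1.1
  simp only [mul_assoc, mul_comm (zpow (-1) f).1.1, hinv, mul_one, one_mul] at hmul
  exact hmul

end expHPlusZero

/-- For each nonzero integer `m`, the pointwise `m`-th power map
`Φ_m : f ↦ f ^ m` (negative powers meaning pointwise powers of the reciprocal,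
i.e. the complex `zpow`) is a bijective homeomorphism of `e^H_{+,0}` onto itself. -/
theorem pow_map_homeomorph_expHPlusZero (m : ℤ) (hm : m ≠ 0) :
    ∃ Φ : ↥expHPlusZero ≃ₜ ↥expHPlusZero,
      ∀ f : ↥expHPlusZero, ∀ z : ℂ,
        ((Φ f : ↥Entire) : C(ℂ, ℂ)) z = (((f : ↥Entire) : C(ℂ, ℂ)) z) ^ m := by
  let e := Equiv.ofBijective (expHPlusZero.zpow m)
    ⟨expHPlusZero.zpow_injective hm, expHPlusZero.zpow_surjective hm⟩
  refine ⟨⟨e, expHPlusZero.continuous_zpow m, continuous_iff_continuousAt.2 fun y =>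
    expHPlusZero.tendsto_of_tendsto_zpow hm ?_⟩, fun _ _ => rfl⟩
  have he : ∀ w, expHPlusZero.zpow m (e.symm w) = w := e.apply_symm_apply
  change Tendsto (fun w => expHPlusZero.zpow m (e.symm w)) _ (𝓝 (expHPlusZero.zpow m (e.symm y)))
  simp only [he]
  exact tendsto_id
end

section
/- No nonempty relatively open subset of e^H_{+,0} is contained in a vector subspace of H(ℂ) of countable dimension. That is, if O ⊆ e^H_{+,0} is nonempty and open in the subspace topology of e^H_{+,0}, and Y ⊆ H(ℂ) is a ℂ-linear subspace spanned by countably many entire functions, then O is not a subset of Y. -/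
set_option synthInstance.maxHeartbeats 800000

/-- The entire function `z ↦ f z * exp (a * z)`. -/
noncomputable def Entire.mulExp (f : ↥Entire) (a : ℂ) : ↥Entire :=
  ⟨⟨fun z => (f : C(ℂ, ℂ)) z * Complex.exp (a * z),
    by fun_prop⟩, by
    have hf : Differentiable ℂ ⇑(f : C(ℂ, ℂ)) := f.2
    change Differentiable ℂ fun z => (f : C(ℂ, ℂ)) z * Complex.exp (a * z)
    fun_prop⟩

theorem Entire.mulExp_apply (f : ↥Entire) (a z : ℂ) :
    (Entire.mulExp f a : C(ℂ, ℂ)) z = (f : C(ℂ, ℂ)) z * Complex.exp (a * z) := rfl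

theorem Entire.mulExp_zero (f : ↥Entire) : Entire.mulExp f 0 = f := by
  ext z
  simp [Entire.mulExp_apply]

theorem Entire.continuous_mulExp (f : ↥Entire) : Continuous (Entire.mulExp f) := by
  refine Continuous.subtype_mk (ContinuousMap.continuous_of_continuous_uncurry _ ?_) _
  change Continuous fun p : ℂ × ℂ => (f : C(ℂ, ℂ)) p.2 * Complex.exp (p.1 * p.2)
  fun_prop

theorem Entire.mulExp_mem_expHPlusZero {f : ↥Entire} (hf : f ∈ expHPlusZero) (a : ℂ) :
    Entire.mulExp f a ∈ expHPlusZero := by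
  obtain ⟨hne, him, hre⟩ := hf
  refine ⟨fun z => mul_ne_zero (hne z) (Complex.exp_ne_zero _), ?_, ?_⟩ <;>
    simpa [Entire.mulExp_apply]

theorem linearIndependent_exp_mul :
    LinearIndependent ℂ fun a z : ℂ => Complex.exp (a * z) := by
  let χ : ℂ → Multiplicative ℂ →* ℂ := fun a =>
    { toFun := fun z => Complex.exp (a * z.toAdd)
      map_one' := by simp
      map_mul' := fun x y => by simp [mul_add, Complex.exp_add] }
  have hχ : Function.Injective χ := by
    intro a b hab
    have h : (fun z : ℂ => Complex.exp (a * z)) = fun z => Complex.exp (b * z) :=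
      funext fun z => DFunLike.congr_fun hab (Multiplicative.ofAdd z)
    have hderiv : ∀ c : ℂ, HasDerivAt (fun z : ℂ => Complex.exp (c * z)) c 0 := fun c => by
      simpa using ((hasDerivAt_id (0 : ℂ)).const_mul c).cexp
    exact (hderiv a).unique (h ▸ hderiv b)
  exact (linearIndependent_monoidHom (Multiplicative ℂ) ℂ).comp χ hχ

theorem Entire.linearIndependent_mulExp {f : ↥Entire} (hf : ∀ z, (f : C(ℂ, ℂ)) z ≠ 0) :
    LinearIndependent ℂ (Entire.mulExp f) := by
  let L : ↥Entire →ₗ[ℂ] (ℂ → ℂ) :=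
    { toFun := fun g z => (g : C(ℂ, ℂ)) z / (f : C(ℂ, ℂ)) z
      map_add' := fun g h => by ext z; simp [add_div]
      map_smul' := fun c g => by ext z; simp [mul_div_assoc] }
  refine LinearIndependent.of_comp L ?_
  convert linearIndependent_exp_mul using 1
  ext a z
  exact mul_div_cancel_left₀ _ (hf z)

/-- No nonempty relatively open subset of `e^H_{+,0}` is contained in a
`ℂ`-linear subspace of `H(ℂ)` of countable dimension (i.e. spanned by countably
many entire functions). -/
theorem relatively_open_not_subset_countable_dimensional_subspace
    (O : Set ↥Entire) (hOnonempty : O.Nonempty) (hOsub : O ⊆ expHPlusZero)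
    (hOopen : ∃ U : Set ↥Entire, IsOpen U ∧ O = U ∩ expHPlusZero)
    (D : Set ↥Entire) (hD : D.Countable) :
    ¬ O ⊆ (Submodule.span ℂ D : Set ↥Entire) := by
  intro hspan
  obtain ⟨U, hU, rfl⟩ := hOopen
  obtain ⟨f, hfU, hf⟩ := hOnonempty
  let S : Set ℂ := Entire.mulExp f ⁻¹' U
  have hS : IsOpen S := hU.preimage (Entire.continuous_mulExp f)
  have hS0 : S.Nonempty := ⟨0, by simpa [S, Entire.mulExp_zero] using hfU⟩
  have hmem : ∀ a : S, Entire.mulExp f a ∈ Submodule.span ℂ D := fun a =>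
    hspan ⟨a.2, Entire.mulExp_mem_expHPlusZero hf a⟩
  have hind : LinearIndependent ℂ fun a : S =>
      (⟨Entire.mulExp f a, hmem a⟩ : Submodule.span ℂ D) :=
    LinearIndependent.of_comp (Submodule.span ℂ D).subtype
      ((Entire.linearIndependent_mulExp hf.1).comp _ Subtype.val_injective)
  have hle : Cardinal.mk S ≤ Cardinal.aleph0 :=
    hind.cardinal_le_rank.trans ((rank_span_le D).trans hD.le_aleph0)
  exact absurd ((continuum_le_cardinal_of_isOpen ℂ hS hS0).trans hle)
    Cardinal.aleph0_lt_continuum.not_ge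
end

section
/- Let S := {g ∈ H(ℂ) : Im g(0) = 0}, regarded as a topological group under addition with the topology inherited from H(ℂ). Then the map T : e^H_{+,0} → S that sends f = e^g (with g ∈ S) to g is a well-defined group isomorphism from (e^H_{+,0}, ·) onto (S, +), and both T and its inverse g ↦ e^g are continuous; i.e., T is a topological group isomorphism. -/
set_option synthInstance.maxHeartbeats 800000

/-- `S`: the set of entire functions `g` with `Im g(0) = 0`, a topological group
under addition. -/
def realAtZero : Set ↥Entire := {g | ((g : C(ℂ, ℂ)) 0).im = 0}

open Topology

/-- A continuous branch of the logarithm of a holomorphic function is holomorphic. -/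
theorem Continuous.differentiable_of_exp {f g : ℂ → ℂ} (hg : Continuous g)
    (hf : Differentiable ℂ f) (h : ∀ z, Complex.exp (g z) = f z) : Differentiable ℂ g := by
  intro w
  have hne : f w ≠ 0 := h w ▸ Complex.exp_ne_zero _
  have hlog : DifferentiableAt ℂ (fun z ↦ Complex.log (f z / f w) + g w) w :=
    (((hf w).div_const _).clog (by simp [hne])).add_const _
  refine hlog.congr_of_eventuallyEq ?_
  have him : Filter.Tendsto (fun z ↦ (g z - g w).im) (𝓝 w) (𝓝 0) := by
    have : Continuous fun z ↦ (g z - g w).im := by fun_prop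
    simpa using this.tendsto w
  filter_upwards [him.eventually (Ioo_mem_nhds (neg_lt_zero.2 Real.pi_pos) Real.pi_pos)] with z hz
  rw [← h z, ← h w, ← Complex.exp_sub, Complex.log_exp hz.1 hz.2.le, sub_add_cancel]

/-- Two continuous logarithms that are both real at a point coincide. -/
theorem Continuous.eq_of_exp_eq {X : Type*} [TopologicalSpace X] [PreconnectedSpace X]
    {g₁ g₂ : X → ℂ} (h₁ : Continuous g₁) (h₂ : Continuous g₂)
    (h : ∀ x, Complex.exp (g₁ x) = Complex.exp (g₂ x)) (x₀ : X)
    (him₁ : (g₁ x₀).im = 0) (him₂ : (g₂ x₀).im = 0) : g₁ = g₂ := by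
  refine Complex.isCoveringMap_exp.eq_of_comp_eq h₁ h₂ (funext fun x ↦ Subtype.ext (h x)) x₀ ?_
  have hpi := Real.pi_pos
  exact Complex.exp_inj_of_neg_pi_lt_of_le_pi (by linarith) (by linarith) (by linarith)
    (by linarith) (h x₀)

theorem continuous_eval_expHPlusZero :
    Continuous fun p : ↥expHPlusZero × ℂ ↦ ((p.1 : ↥Entire) : C(ℂ, ℂ)) p.2 := by
  have h : Continuous fun p : ↥expHPlusZero × ℂ ↦ (((p.1 : ↥Entire) : C(ℂ, ℂ)), p.2) :=
    (continuous_subtype_val.comp (continuous_subtype_val.comp continuous_fst)).prodMk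
      continuous_snd
  exact ContinuousEval.continuous_eval.comp h

/-- The logarithms, real at the origin, of the elements of `e^H_{+,0}` can be chosen to depend
jointly continuously on the function and the variable. -/
theorem exists_continuous_log_expHPlusZero :
    ∃ L : C(↥expHPlusZero × ℂ, ℂ),
      (∀ f z, Complex.exp (L (f, z)) = ((f : ↥Entire) : C(ℂ, ℂ)) z) ∧ ∀ f, (L (f, 0)).im = 0 := by
  have hev := continuous_eval_expHPlusZero
  let H : C(unitInterval × (↥expHPlusZero × ℂ), {z : ℂ // z ≠ 0}) :=
    ⟨fun p ↦ ⟨((p.2.1 : ↥Entire) : C(ℂ, ℂ)) ((p.1 : ℝ) * p.2.2), p.2.1.2.1 _⟩,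
      Continuous.subtype_mk (hev.comp (f := fun p : unitInterval × (↥expHPlusZero × ℂ) ↦
        (p.2.1, ((p.1 : ℝ) : ℂ) * p.2.2)) (by fun_prop)) _⟩
  have hlog : Continuous fun f : ↥expHPlusZero ↦
      Complex.log (((f : ↥Entire) : C(ℂ, ℂ)) 0) :=
    (hev.comp (f := fun f : ↥expHPlusZero ↦ (f, (0 : ℂ))) (by fun_prop)).clog
      fun f ↦ Or.inl f.2.2.2
  let l : C(↥expHPlusZero × ℂ, ℂ) := ⟨_, hlog.comp continuous_fst⟩
  have hl (p) : Complex.exp (l p) = ((p.1 : ↥Entire) : C(ℂ, ℂ)) 0 := Complex.exp_log (p.1.2.1 0)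
  have H_0 (a) : H (0, a) = ⟨Complex.exp (l a), Complex.exp_ne_zero _⟩ :=
    Subtype.ext (by simp [H, hl])
  let Γ := Complex.isCoveringMap_exp.liftHomotopy H l H_0
  have hΓ (f : ↥expHPlusZero) (z : ℂ) :
      Complex.exp (Γ (1, (f, z))) = ((f : ↥Entire) : C(ℂ, ℂ)) z := by
    have := congrArg Subtype.val
      (congrFun (Complex.isCoveringMap_exp.liftHomotopy_lifts H l H_0) (1, (f, z)))
    refine this.trans ?_
    simp [H]
  refine ⟨⟨fun p ↦ Γ (1, p) - Γ (1, (p.1, 0)) + l p, by fun_prop⟩, fun f z ↦ ?_, fun f ↦ ?_⟩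
  · change Complex.exp (Γ (1, (f, z)) - Γ (1, (f, 0)) + l (f, z)) = _
    rw [Complex.exp_add, Complex.exp_sub, hΓ, hΓ, hl, div_mul_cancel₀ _ (f.2.1 0)]
  · change (Γ (1, (f, 0)) - Γ (1, (f, 0)) + Complex.log (((f : ↥Entire) : C(ℂ, ℂ)) 0)).im = 0
    rw [sub_self, zero_add, Complex.log_im, Complex.arg_eq_zero_iff]
    exact ⟨f.2.2.2.le, f.2.2.1⟩

theorem mul_mem_expHPlusZero {f g : ↥Entire} (hf : f ∈ expHPlusZero) (hg : g ∈ expHPlusZero) :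
    f * g ∈ expHPlusZero := by
  obtain ⟨hf, hfi, hfr⟩ := hf
  obtain ⟨hg, hgi, hgr⟩ := hg
  refine ⟨fun z ↦ mul_ne_zero (hf z) (hg z), ?_, ?_⟩
  · change ((f : C(ℂ, ℂ)) 0 * (g : C(ℂ, ℂ)) 0).im = 0
    simp [hfi, hgi]
  · change 0 < ((f : C(ℂ, ℂ)) 0 * (g : C(ℂ, ℂ)) 0).re
    simpa [hfi, hgi] using mul_pos hfr hgr

theorem add_mem_realAtZero {g h : ↥Entire} (hg : g ∈ realAtZero) (hh : h ∈ realAtZero) :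
    g + h ∈ realAtZero := by
  change ((g : C(ℂ, ℂ)) 0 + (h : C(ℂ, ℂ)) 0).im = 0
  rw [Complex.add_im, show ((g : C(ℂ, ℂ)) 0).im = 0 from hg,
    show ((h : C(ℂ, ℂ)) 0).im = 0 from hh, add_zero]

/-- The exponential map `g ↦ e^g` from `S` to `e^H_{+,0}`. -/
noncomputable def expRealAtZero (g : ↥realAtZero) : ↥expHPlusZero :=
  ⟨⟨(⟨Complex.exp, Complex.continuous_exp⟩ : C(ℂ, ℂ)).comp ((g : ↥Entire) : C(ℂ, ℂ)),
      Complex.differentiable_exp.comp (g : ↥Entire).2⟩,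
    fun _ ↦ Complex.exp_ne_zero _, by
      have hg : (((g : ↥Entire) : C(ℂ, ℂ)) 0).im = 0 := g.2
      simp [Complex.exp_im, Complex.exp_re, hg, Real.exp_pos]⟩

theorem continuous_expRealAtZero : Continuous expRealAtZero :=
  (((ContinuousMap.continuous_postcomp _).comp
    (continuous_subtype_val.comp continuous_subtype_val)).subtype_mk _).subtype_mk _

/-- An element of `S` is determined by its exponential. -/
theorem eq_of_exp_eq_realAtZero {g h : ↥Entire} (hg : g ∈ realAtZero) (hh : h ∈ realAtZero)
    (H : ∀ z, Complex.exp ((g : C(ℂ, ℂ)) z) = Complex.exp ((h : C(ℂ, ℂ)) z)) : g = h :=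
  Subtype.ext <| DFunLike.coe_injective <|
    Continuous.eq_of_exp_eq (map_continuous (g : C(ℂ, ℂ))) (map_continuous (h : C(ℂ, ℂ))) H 0 hg hh

/-- The logarithm map `T : (e^H_{+,0}, ·) → (S, +)`, sending `f = e^g` (with
`Im g(0) = 0`) to `g`, is a well-defined group isomorphism that is moreover a
homeomorphism, i.e. a topological group isomorphism. -/
theorem exists_log_topological_group_isomorphism :
    (∀ f g : ↥expHPlusZero, (f : ↥Entire) * (g : ↥Entire) ∈ expHPlusZero) ∧
    (∀ g h : ↥realAtZero, (g : ↥Entire) + (h : ↥Entire) ∈ realAtZero) ∧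
    ∃ T : ↥expHPlusZero ≃ₜ ↥realAtZero,
      (∀ f : ↥expHPlusZero, ∀ z : ℂ,
        Complex.exp (((T f : ↥Entire) : C(ℂ, ℂ)) z) = ((f : ↥Entire) : C(ℂ, ℂ)) z) ∧
      (∀ f g h : ↥expHPlusZero, (h : ↥Entire) = (f : ↥Entire) * (g : ↥Entire) →
        (T h : ↥Entire) = (T f : ↥Entire) + (T g : ↥Entire)) := by
  refine ⟨fun f g ↦ mul_mem_expHPlusZero f.2 g.2, fun g h ↦ add_mem_realAtZero g.2 h.2, ?_⟩
  obtain ⟨L, hL, hL₀⟩ := exists_continuous_log_expHPlusZero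
  let T (f : ↥expHPlusZero) : ↥realAtZero :=
    ⟨⟨L.curry f, (map_continuous (L.curry f)).differentiable_of_exp (f : ↥Entire).2 (hL f)⟩, hL₀ f⟩
  have hT (f : ↥expHPlusZero) (z : ℂ) :
      Complex.exp (((T f : ↥Entire) : C(ℂ, ℂ)) z) = ((f : ↥Entire) : C(ℂ, ℂ)) z := hL f z
  have hTc : Continuous T := ((map_continuous L.curry).subtype_mk _).subtype_mk _
  refine ⟨⟨⟨T, expRealAtZero, fun f ↦ ?_, fun g ↦ ?_⟩, hTc, continuous_expRealAtZero⟩, hT,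
    fun f g h hfg ↦ ?_⟩
  · exact Subtype.ext <| Subtype.ext <| ContinuousMap.ext (hT f)
  · exact Subtype.ext <| eq_of_exp_eq_realAtZero (T _).2 g.2 (hT (expRealAtZero g))
  · refine eq_of_exp_eq_realAtZero (T h).2 (add_mem_realAtZero (T f).2 (T g).2) fun z ↦ ?_
    change Complex.exp (((T h : ↥Entire) : C(ℂ, ℂ)) z) =
      Complex.exp (((T f : ↥Entire) : C(ℂ, ℂ)) z + ((T g : ↥Entire) : C(ℂ, ℂ)) z)
    rw [Complex.exp_add, hT, hT, hT, hfg]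
    rfl
end

section
/- Let G ⊆ ℂ be a simply connected domain (a nonempty connected open set whose complement in the Riemann sphere is connected), let φ be a holomorphic automorphism of G with no fixed point, and let C_φ : H(G) → H(G) be the composition operator C_φ(f) = f ∘ φ. Then for every f ∈ HC(C_φ) there exists a family F ⊆ H(G) such that: (a) f ∈ F and F ⊆ HC(C_φ); (b) F is dense in H(G); (c) for every finite nonempty subfamily F₀ ⊆ F, the pointwise product ∏_{g ∈ F₀} g belongs to HC(C_φ); and (d) F is linearly independent over ℂ. -/
open Function

/-- `h ∈ H(G)` is hypercyclic for the composition operator `C_φ` on `H(G)`: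
the orbit `{h ∘ φⁿ : n ∈ ℕ}` is dense in `H(G)` for the topology of uniform
convergence on compact subsets of `G`. -/
def HypercyclicForComp (G : Set ℂ) (φ : ℂ → ℂ) (h : ℂ → ℂ) : Prop :=
  ∀ g : ℂ → ℂ, DifferentiableOn ℂ g G →
    ∀ K : Set ℂ, K ⊆ G → IsCompact K →
      ∀ ε : ℝ, 0 < ε → ∃ n : ℕ, ∀ z ∈ K, dist (h (φ^[n] z)) (g z) < ε


open Filter Topology Set

theorem ContinuousMap.nhds_basis_dist_lt {X : Type*} [TopologicalSpace X] (g : C(X, ℂ)) :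
    (𝓝 g).HasBasis (fun p : Set X × ℝ => IsCompact p.1 ∧ 0 < p.2)
      (fun p => {g' : C(X, ℂ) | ∀ z ∈ p.1, dist (g' z) (g z) < p.2}) := by
  have h := nhds_basis_uniformity'
    (Metric.uniformity_basis_dist (α := ℂ)).compactConvergenceUniformity (x := g)
  convert h using 2
  ext g'
  simp [UniformSpace.ball, dist_comm]

section Abstract

variable {X : Type*} [TopologicalSpace X]

/-- Iterating `w ↦ 3 w² - 2 w³`, which has superattracting fixed points at `0` and `1`, produces
an element of `A` that is close to `0` where `f` is small and close to `1` where `f` is near `c`. -/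
theorem Subalgebra.exists_separating (A : Subalgebra ℂ C(X, ℂ)) {f : C(X, ℂ)} (hf : f ∈ A)
    {c : ℂ} (hc : c ≠ 0) {η : ℝ} (hη : 0 < η) :
    ∃ u ∈ A, (∀ z, ‖f z‖ ≤ ‖c‖ / 4 → ‖u z‖ < η) ∧ (∀ z, ‖f z - c‖ ≤ ‖c‖ / 4 → ‖u z - 1‖ < η) := by
  have hc' : 0 < ‖c‖ := norm_pos_iff.2 hc
  have smooth : ∀ w : ℂ, ∀ r : ℝ, r ≤ 1 / 4 → ‖w‖ ≤ r → ‖3 * w ^ 2 - 2 * w ^ 3‖ ≤ 7 / 8 * r := by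
    intro w r hr hw
    have h0 := norm_nonneg w
    calc ‖3 * w ^ 2 - 2 * w ^ 3‖ ≤ ‖3 * w ^ 2‖ + ‖2 * w ^ 3‖ := norm_sub_le _ _
      _ = 3 * ‖w‖ ^ 2 + 2 * ‖w‖ ^ 3 := by simp
      _ ≤ 3 * r ^ 2 + 2 * r ^ 3 := by gcongr
      _ ≤ 7 / 8 * r := by
        have : 0 ≤ r := h0.trans hw
        nlinarith [mul_nonneg this (sub_nonneg.2 hr),
          mul_nonneg (mul_nonneg this this) (sub_nonneg.2 hr)]
  have iter : ∀ j : ℕ, ∃ u ∈ A, (∀ z, ‖f z‖ ≤ ‖c‖ / 4 → ‖u z‖ ≤ (7 / 8) ^ j * (1 / 4)) ∧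
      (∀ z, ‖f z - c‖ ≤ ‖c‖ / 4 → ‖1 - u z‖ ≤ (7 / 8) ^ j * (1 / 4)) := by
    intro j
    induction j with
    | zero =>
      refine ⟨c⁻¹ • f, A.smul_mem hf _, fun z hz => ?_, fun z hz => ?_⟩
      · rw [ContinuousMap.smul_apply, norm_smul, norm_inv, inv_mul_le_iff₀ hc']
        linarith
      · have : 1 - (c⁻¹ • f) z = c⁻¹ * (c - f z) := by
          simp [mul_sub, hc]
        rw [this, norm_mul, norm_inv, inv_mul_le_iff₀ hc', norm_sub_rev]
        linarith
    | succ j ih =>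
      obtain ⟨u, huA, h0, h1⟩ := ih
      have hr : ((7 : ℝ) / 8) ^ j * (1 / 4) ≤ 1 / 4 := by
        have : ((7 : ℝ) / 8) ^ j ≤ 1 := pow_le_one₀ (by norm_num) (by norm_num)
        linarith
      refine ⟨(3 : ℂ) • u ^ 2 - (2 : ℂ) • u ^ 3,
        A.sub_mem (A.smul_mem (A.pow_mem huA _) _) (A.smul_mem (A.pow_mem huA _) _),
        fun z hz => ?_, fun z hz => ?_⟩
      · have := smooth _ _ hr (h0 z hz)
        simp only [ContinuousMap.sub_apply, ContinuousMap.smul_apply, ContinuousMap.pow_apply,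
          smul_eq_mul]
        rw [pow_succ' (7 / 8 : ℝ) j]
        linarith
      · have := smooth _ _ hr (h1 z hz)
        simp only [ContinuousMap.sub_apply, ContinuousMap.smul_apply, ContinuousMap.pow_apply,
          smul_eq_mul]
        rw [pow_succ' (7 / 8 : ℝ) j]
        have e : 1 - (3 * u z ^ 2 - 2 * u z ^ 3) = 3 * (1 - u z) ^ 2 - 2 * (1 - u z) ^ 3 := by ring
        rw [e]
        linarith
  obtain ⟨j, hj⟩ := exists_pow_lt_of_lt_one hη (by norm_num : (7 / 8 : ℝ) < 1)
  obtain ⟨u, huA, h0, h1⟩ := iter j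
  have hj' : ((7 : ℝ) / 8) ^ j * (1 / 4) < η := by
    have : (0 : ℝ) < (7 / 8) ^ j := by positivity
    linarith
  exact ⟨u, huA, fun z hz => (h0 z hz).trans_lt hj',
    fun z hz => by rw [norm_sub_rev]; exact (h1 z hz).trans_lt hj'⟩

/-- The orbit of `f` under composition with `Φ` approximates every element of `A`
uniformly on compact sets. -/
def HasDenseOrbitIn (A : Subalgebra ℂ C(X, ℂ)) (Φ : C(X, X)) (f : C(X, ℂ)) : Prop :=
  ∀ g ∈ A, ∀ K : Set X, IsCompact K → ∀ ε : ℝ, 0 < ε →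
    ∃ n : ℕ, ∀ z ∈ K, dist (f (Φ^[n] z)) (g z) < ε

variable {A : Subalgebra ℂ C(X, ℂ)} {Φ : C(X, X)} {f : C(X, ℂ)}

/-- The approximating index in a dense orbit can be taken arbitrarily large. -/
theorem HasDenseOrbitIn.exists_ge (hf : HasDenseOrbitIn A Φ f) {g : C(X, ℂ)} (hg : g ∈ A)
    {K : Set X} (hK : IsCompact K) {ε : ℝ} (hε : 0 < ε) (N : ℕ) :
    ∃ n, N ≤ n ∧ ∀ z ∈ K, dist (f (Φ^[n] z)) (g z) < ε := by
  rcases K.eq_empty_or_nonempty with rfl | ⟨z₀, hz₀⟩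
  · exact ⟨N, le_rfl, by simp⟩
  have hinf : (Metric.ball (0 : ℂ) (ε / 2)).Infinite :=
    infinite_of_mem_nhds 0 (Metric.ball_mem_nhds _ (by positivity))
  obtain ⟨t, ht, htS⟩ := hinf.exists_notMem_finset
    ((Finset.range N).image fun k => f (Φ^[k] z₀) - g z₀)
  have hclosed : IsClosed
      (((Finset.range N).image fun k => f (Φ^[k] z₀) - g z₀ : Finset ℂ) : Set ℂ) :=
    Finset.isClosed _
  obtain ⟨δ, hδ, hδS⟩ := Metric.mem_nhds_iff.1 (hclosed.isOpen_compl.mem_nhds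
    (by simpa using htS : t ∈ _))
  obtain ⟨n, hn⟩ := hf (g + algebraMap ℂ C(X, ℂ) t) (A.add_mem hg (A.algebraMap_mem t)) K hK
    (min δ (ε / 2)) (by positivity)
  refine ⟨n, ?_, fun z hz => ?_⟩
  · by_contra! hlt
    have h1 := (hn z₀ hz₀).trans_le (min_le_left _ _)
    have h2 : f (Φ^[n] z₀) - g z₀ ∈ Metric.ball t δ := by
      rw [Metric.mem_ball, dist_eq_norm]
      rw [dist_eq_norm] at h1
      simpa [Algebra.algebraMap_eq_smul_one, sub_sub] using h1
    exact hδS h2 (by simpa using ⟨n, hlt, rfl⟩)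
  · have h1 := (hn z hz).trans_le (min_le_right _ _)
    rw [mem_ball_zero_iff] at ht
    have h2 : dist ((g + algebraMap ℂ C(X, ℂ) t) z) (g z) < ε / 2 := by
      rw [dist_eq_norm]
      simpa [Algebra.algebraMap_eq_smul_one] using ht
    linarith [dist_triangle (f (Φ^[n] z)) ((g + algebraMap ℂ C(X, ℂ) t) z) (g z)]

/-- Elements of `A` can be prescribed approximately on `K` and on `Φ^[n] '' K` simultaneously, for
some `n` for which `f ∘ Φ^[n]` is nearly constant on `K`. -/
theorem HasDenseOrbitIn.exists_interpolation (hf : HasDenseOrbitIn A Φ f) (hfA : f ∈ A)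
    (hΦ : ∀ g ∈ A, g.comp Φ ∈ A) {K : Set X} (hK : IsCompact K) :
    ∃ c : ℂ, c ≠ 0 ∧ ∀ δ : ℝ, 0 < δ → ∃ n : ℕ, (∀ z ∈ K, ‖f (Φ^[n] z) - c‖ < δ) ∧
      ∀ g ∈ A, ∀ h ∈ A, ∀ ε : ℝ, 0 < ε → ∃ g' ∈ A, (∀ z ∈ K, ‖g' z - g z‖ < ε) ∧
        ∀ z ∈ K, ‖g' (Φ^[n] z) - h z‖ < ε := by
  have bdd : ∀ (g : C(X, ℂ)) (L : Set X), IsCompact L → ∃ M : ℝ, 0 < M ∧ ∀ z ∈ L, ‖g z‖ ≤ M := by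
    intro g L hL
    obtain ⟨M, hM⟩ := hL.exists_bound_of_continuousOn g.continuous.continuousOn
    exact ⟨max M 1, by positivity, fun z hz => (hM z hz).trans (le_max_left _ _)⟩
  have hit : ∀ (g : C(X, ℂ)), g ∈ A → ∀ m : ℕ, ∃ g' ∈ A, ∀ z, g' z = g (Φ^[m] z) := by
    intro g hg m
    induction m with
    | zero => exact ⟨g, hg, fun z => rfl⟩
    | succ m ih =>
      obtain ⟨g', hg', h⟩ := ih
      exact ⟨g'.comp Φ, hΦ _ hg', fun z => by simp [h, Function.iterate_succ_apply]⟩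
  obtain ⟨M, hM0, hM⟩ := bdd f K hK
  have hcn : ‖((4 * M : ℝ) : ℂ)‖ = 4 * M := by
    rw [Complex.norm_real, Real.norm_of_nonneg (by positivity)]
  have hc : ((4 * M : ℝ) : ℂ) ≠ 0 := by rw [← norm_pos_iff, hcn]; positivity
  refine ⟨((4 * M : ℝ) : ℂ), hc, fun δ hδ => ?_⟩
  set c : ℂ := ((4 * M : ℝ) : ℂ)
  obtain ⟨n, hn⟩ := hf (algebraMap ℂ C(X, ℂ) c) (A.algebraMap_mem c) K hK (min δ M) (by positivity)
  have hn' : ∀ z ∈ K, ‖f (Φ^[n] z) - c‖ < min δ M := by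
    intro z hz
    simpa [dist_eq_norm, Algebra.algebraMap_eq_smul_one] using hn z hz
  refine ⟨n, fun z hz => (hn' z hz).trans_le (min_le_left _ _), fun g hg h hh ε hε => ?_⟩
  obtain ⟨k, hnk, hk⟩ := hf.exists_ge hh hK (half_pos hε) n
  obtain ⟨m, rfl⟩ := Nat.exists_eq_add_of_le' hnk
  obtain ⟨v, hvA, hv⟩ := hit f hfA m
  have hL : IsCompact (K ∪ Φ^[n] '' K) :=
    hK.union (hK.image (Φ.continuous.iterate n))
  obtain ⟨B, hB0, hB⟩ := bdd (v - g) _ hL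
  obtain ⟨u, huA, hu0, hu1⟩ := A.exists_separating hfA hc (η := ε / (2 * B)) (by positivity)
  have hηB : ε / (2 * B) * B = ε / 2 := by field_simp
  refine ⟨g + u * (v - g), A.add_mem hg (A.mul_mem huA (A.sub_mem hvA hg)), fun z hz => ?_,
    fun z hz => ?_⟩
  · have h1 := hu0 z (by rw [hcn]; linarith [hM z hz])
    have h2 := hB z (Or.inl hz)
    calc ‖(g + u * (v - g)) z - g z‖ = ‖u z‖ * ‖(v - g) z‖ := by rw [← norm_mul]; simp
      _ ≤ ε / (2 * B) * B := by gcongr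
      _ < ε := by linarith
  · have h1 := hu1 (Φ^[n] z) (by
      rw [hcn]; linarith [(hn' z hz).trans_le (min_le_right _ _)])
    have h2 := hB (Φ^[n] z) (Or.inr ⟨z, hz, rfl⟩)
    have h3 := hk z hz
    rw [Function.iterate_add_apply, ← hv, dist_eq_norm] at h3
    have e : (g + u * (v - g)) (Φ^[n] z) - h z
        = (u (Φ^[n] z) - 1) * (v - g) (Φ^[n] z) + (v (Φ^[n] z) - h z) := by
      simp; ring
    calc ‖(g + u * (v - g)) (Φ^[n] z) - h z‖
        ≤ ‖u (Φ^[n] z) - 1‖ * ‖(v - g) (Φ^[n] z)‖ + ‖v (Φ^[n] z) - h z‖ := by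
          rw [e, ← norm_mul]; exact norm_add_le _ _
      _ < ε / (2 * B) * B + ε / 2 :=
          add_lt_add_of_le_of_lt (by gcongr) h3
      _ = ε := by linarith

/-- Finite products are continuous, uniformly over a compact set. -/
theorem exists_pos_norm_prod_sub_lt {ι : Type*} (t : ι → C(X, ℂ)) {K : Set X} (hK : IsCompact K)
    (T : Finset ι) {ε : ℝ} (hε : 0 < ε) :
    ∃ δ : ℝ, 0 < δ ∧ ∀ z ∈ K, ∀ a : ι → ℂ, (∀ i ∈ T, ‖a i - t i z‖ < δ) →
      ‖∏ i ∈ T, a i - ∏ i ∈ T, t i z‖ < ε := by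
  classical
  induction T using Finset.induction_on generalizing ε with
  | empty => exact ⟨1, one_pos, by simpa using fun _ _ => hε⟩
  | insert i T hi ih =>
    obtain ⟨M₁, hM₁⟩ := hK.exists_bound_of_continuousOn (t i).continuous.continuousOn
    obtain ⟨M₂, hM₂⟩ := hK.exists_bound_of_continuousOn (∏ i ∈ T, t i).continuous.continuousOn
    obtain ⟨M, hM0, hMM⟩ : ∃ M : ℝ, 0 < M ∧ M₁ ≤ M ∧ M₂ ≤ M :=
      ⟨max 1 (max M₁ M₂), by positivity, by simp, by simp⟩
    set e := min 1 (ε / (2 * M + 2)) with he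
    have he0 : 0 < e := by positivity
    have he1 : e ≤ 1 := min_le_left _ _
    have heε : e * (2 * M + 1) < ε := by
      have : e * (2 * M + 2) ≤ ε := by
        rw [← le_div_iff₀ (by positivity)]; exact min_le_right _ _
      nlinarith
    obtain ⟨δ, hδ, h⟩ := ih he0
    refine ⟨min δ e, by positivity, fun z hz a ha => ?_⟩
    rw [Finset.prod_insert hi, Finset.prod_insert hi]
    have hP := h z hz a fun j hj =>
      (ha j (Finset.mem_insert_of_mem hj)).trans_le (min_le_left _ _)
    have hai := (ha i (Finset.mem_insert_self i T)).trans_le (min_le_right _ _)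
    have h1 := (hM₁ z hz).trans hMM.1
    have h2 := (hM₂ z hz).trans hMM.2
    rw [ContinuousMap.prod_apply] at h2
    set P := ∏ i ∈ T, a i
    set Q := ∏ i ∈ T, t i z
    have e1 : a i * P - t i z * Q = (a i - t i z) * (P - Q) + (a i - t i z) * Q
      + t i z * (P - Q) := by ring
    rw [e1]
    calc _ ≤ ‖a i - t i z‖ * ‖P - Q‖ + ‖a i - t i z‖ * ‖Q‖ + ‖t i z‖ * ‖P - Q‖ := by
          rw [← norm_mul, ← norm_mul, ← norm_mul]; exact norm_add₃_le
      _ ≤ e * 1 + e * M + M * e := by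
          have := hP.le.trans he1
          gcongr
      _ < ε := by linarith

theorem exists_finset_compact_of_mem_nhds_pi {x : ℕ → A} {U : Set (ℕ → A)} (hU : U ∈ 𝓝 x) :
    ∃ (I : Finset ℕ) (K : Set X) (ε : ℝ), IsCompact K ∧ 0 < ε ∧ ∀ x' : ℕ → A,
      (∀ i ∈ I, ∀ z ∈ K, ‖(x' i : C(X, ℂ)) z - (x i : C(X, ℂ)) z‖ < ε) → x' ∈ U := by
  rw [nhds_pi, Filter.mem_pi'] at hU
  obtain ⟨I, V, hV, hVU⟩ := hU
  have h : ∀ i, ∃ (K : Set X) (ε : ℝ), IsCompact K ∧ 0 < ε ∧ ∀ a : A,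
      (∀ z ∈ K, ‖(a : C(X, ℂ)) z - (x i : C(X, ℂ)) z‖ < ε) → a ∈ V i := by
    intro i
    obtain ⟨W, hW, hWV⟩ := mem_nhds_subtype _ _ _ |>.1 (hV i)
    obtain ⟨⟨K, ε⟩, ⟨hK, hε⟩, h⟩ := (ContinuousMap.nhds_basis_dist_lt _).mem_iff.1 hW
    exact ⟨K, ε, hK, hε, fun a ha => hWV (h (by simpa [dist_eq_norm] using ha))⟩
  choose K ε hK hε h using h
  obtain ⟨e, he0, he⟩ : ∃ e : ℝ, 0 < e ∧ ∀ i ∈ I, e ≤ ε i := by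
    rcases I.eq_empty_or_nonempty with rfl | hI
    · exact ⟨1, one_pos, by simp⟩
    · obtain ⟨j, _, hj⟩ := I.exists_min_image ε hI
      exact ⟨ε j, hε j, hj⟩
  refine ⟨I, ⋃ i ∈ I, K i, e, I.isCompact_biUnion fun i _ => hK i, he0, fun x' hx' => hVU ?_⟩
  exact fun i hi => h i _ fun z hz =>
    (hx' i hi z (mem_biUnion (Finset.mem_coe.2 hi) hz)).trans_le (he i hi)

theorem HasDenseOrbitIn.exists_mem_nhds_interpolation (hf : HasDenseOrbitIn A Φ f) (hfA : f ∈ A)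
    (hΦ : ∀ g ∈ A, g.comp Φ ∈ A) {K : Set X} (hK : IsCompact K) {x : ℕ → A} {U : Set (ℕ → A)}
    (hU : U ∈ 𝓝 x) :
    ∃ c : ℂ, c ≠ 0 ∧ ∀ t : Option ℕ → A, (∀ z, (t none : C(X, ℂ)) z = c) → ∀ δ : ℝ, 0 < δ →
      ∃ n : ℕ, ∃ x' ∈ U, ∀ o : Option ℕ, ∀ z ∈ K,
        ‖o.elim f (fun k => (x' k : C(X, ℂ))) (Φ^[n] z) - (t o : C(X, ℂ)) z‖ < δ := by
  obtain ⟨I, L, ε, hL, hε, hI⟩ := exists_finset_compact_of_mem_nhds_pi hU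
  obtain ⟨c, hc, h⟩ := hf.exists_interpolation hfA hΦ (hK.union hL)
  refine ⟨c, hc, fun t ht δ hδ => ?_⟩
  obtain ⟨n, hn, hg⟩ := h δ hδ
  choose g hgA hg1 hg2 using fun k : ℕ => hg (x k) (x k).2 (t (some k)) (t (some k)).2
    (min ε δ) (by positivity)
  refine ⟨n, fun k => ⟨g k, hgA k⟩, hI _ fun i _ z hz =>
    (hg1 i z (Or.inr hz)).trans_le (min_le_left _ _), ?_⟩
  rintro (_ | k) z hz
  · simpa [ht] using hn z (Or.inl hz)
  · exact (hg2 k z (Or.inl hz)).trans_le (min_le_right _ _)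

theorem continuous_elim_coe (f : C(X, ℂ)) (o : Option ℕ) :
    Continuous fun x : ℕ → A => (o.elim f fun k => (x k : C(X, ℂ)) : C(X, ℂ)) := by
  cases o with
  | none => exact continuous_const
  | some k => exact continuous_subtype_val.comp (continuous_apply k)

theorem dense_exists_apply_mem {B : Set A} (hB : B.Nonempty) :
    Dense {x : ℕ → A | ∃ k, x k ∈ B} := by
  classical
  obtain ⟨b, hb⟩ := hB
  rw [dense_iff_inter_open]
  rintro U hU ⟨x, hx⟩
  obtain ⟨I, L, ε, hL, hε, hI⟩ := exists_finset_compact_of_mem_nhds_pi (hU.mem_nhds hx)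
  obtain ⟨k, hk⟩ := Infinite.exists_notMem_finset I
  refine ⟨Function.update x k b, hI _ fun i hi z _ => ?_, k, by simpa using hb⟩
  rw [Function.update_of_ne (ne_of_mem_of_not_mem hi hk)]
  simpa using hε

theorem HasDenseOrbitIn.dense_exists_prod_comp_mem (hf : HasDenseOrbitIn A Φ f) (hfA : f ∈ A)
    (hΦ : ∀ g ∈ A, g.comp Φ ∈ A) {T : Finset (Option ℕ)} (hT : T.Nonempty)
    {B : Set C(X, ℂ)} (hB : IsOpen B) (hBA : (B ∩ A).Nonempty) :
    Dense {x : ℕ → A | ∃ n : ℕ, (∏ o ∈ T, (o.elim f fun k => (x k : C(X, ℂ)) : C(X, ℂ))).comp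
      ⟨Φ^[n], Φ.continuous.iterate n⟩ ∈ B} := by
  classical
  obtain ⟨h, hhB, hhA⟩ := hBA
  obtain ⟨⟨K, ε⟩, ⟨hK, hε⟩, hKB⟩ :=
    (ContinuousMap.nhds_basis_dist_lt _).mem_iff.1 (hB.mem_nhds hhB)
  by_cases hk : ∃ k, some k ∈ T
  · obtain ⟨k, hk⟩ := hk
    rw [dense_iff_inter_open]
    rintro U hU ⟨x, hx⟩
    obtain ⟨c, hc, hn⟩ := hf.exists_mem_nhds_interpolation hfA hΦ hK (hU.mem_nhds hx)
    set c' : ℂ := if none ∈ T then c else 1 with hc'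
    have hc'0 : c' ≠ 0 := by rw [hc']; split_ifs <;> simp [hc]
    let t : Option ℕ → A := fun o => o.elim (algebraMap ℂ A c)
      fun i => if i = k then c'⁻¹ • ⟨h, hhA⟩ else 1
    have ht : ∀ z, ∏ o ∈ T, (t o : C(X, ℂ)) z = h z := by
      intro z
      rw [← Finset.mul_prod_erase T _ hk]
      have h1 : ∏ o ∈ T.erase (some k), (t o : C(X, ℂ)) z = c' := by
        have : ∀ o ∈ T.erase (some k), (t o : C(X, ℂ)) z = if o = none then c else 1 := by
          rintro (_ | i) hi
          · simp [t, Algebra.algebraMap_eq_smul_one]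
          · have : i ≠ k := by rintro rfl; simp at hi
            simp [t, this]
        rw [Finset.prod_congr rfl this, Finset.prod_ite_eq']
        simp [hc']
      rw [h1]
      simp [t]
      field_simp
    obtain ⟨δ, hδ, hδT⟩ := exists_pos_norm_prod_sub_lt (fun o => (t o : C(X, ℂ))) hK T hε
    obtain ⟨n, x', hx'U, hx'⟩ := hn t (fun z => by simp [t, Algebra.algebraMap_eq_smul_one]) δ hδ
    refine ⟨x', hx'U, n, hKB fun z hz => ?_⟩
    rw [dist_eq_norm, ← ht z]
    simpa [ContinuousMap.prod_apply] using hδT z hz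
      (fun o => (o.elim f fun k => (x' k : C(X, ℂ)) : C(X, ℂ)) (Φ^[n] z)) fun o _ => hx' o z hz
  · have hTn : T = {none} := by
      refine Finset.eq_singleton_iff_nonempty_unique_mem.2 ⟨hT, ?_⟩
      rintro (_ | i) hi
      · rfl
      · exact (hk ⟨i, hi⟩).elim
    obtain ⟨n, hn⟩ := hf h hhA K hK ε hε
    have : ∀ x : ℕ → A, ∃ n : ℕ, (∏ o ∈ T, (o.elim f fun k => (x k : C(X, ℂ)) : C(X, ℂ))).comp
      ⟨Φ^[n], Φ.continuous.iterate n⟩ ∈ B := fun x =>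
      ⟨n, hKB fun z hz => by simpa [hTn] using hn z hz⟩
    simp [this]

theorem HasDenseOrbitIn.dense_exists_mul_sum_lt [Nonempty X] (hf : HasDenseOrbitIn A Φ f)
    (hfA : f ∈ A) (hΦ : ∀ g ∈ A, g.comp Φ ∈ A) {T : Finset (Option ℕ)} {k : ℕ} (hk : some k ∉ T)
    (N : ℕ) :
    Dense {x : ℕ → A | ∃ z : X, N * ∑ o ∈ T, ‖(o.elim f fun k => (x k : C(X, ℂ)) : C(X, ℂ)) z‖
      < ‖(x k : C(X, ℂ)) z‖} := by
  classical
  obtain ⟨z₀⟩ := ‹Nonempty X›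
  rw [dense_iff_inter_open]
  rintro U hU ⟨x, hx⟩
  obtain ⟨c, hc, hn⟩ := hf.exists_mem_nhds_interpolation hfA hΦ (isCompact_singleton (x := z₀))
    (hU.mem_nhds hx)
  set R : ℝ := N * (T.card * (‖c‖ + 1)) + 1 with hR
  have hR0 : 0 ≤ R := by positivity
  let t : Option ℕ → A := fun o => o.elim (algebraMap ℂ A c)
    fun i => if i = k then algebraMap ℂ A R else 0
  obtain ⟨n, x', hx'U, hx'⟩ := hn t (fun z => by simp [t, Algebra.algebraMap_eq_smul_one]) 1
    one_pos
  refine ⟨x', hx'U, Φ^[n] z₀, ?_⟩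
  have h1 : ∀ o ∈ T, ‖(o.elim f fun k => (x' k : C(X, ℂ)) : C(X, ℂ)) (Φ^[n] z₀)‖ ≤ ‖c‖ + 1 := by
    intro o ho
    have ht : ‖(t o : C(X, ℂ)) z₀‖ ≤ ‖c‖ := by
      rcases o with _ | i
      · simp [t, Algebra.algebraMap_eq_smul_one]
      · have : i ≠ k := by rintro rfl; exact hk ho
        simp [t, this]
    have := hx' o z₀ rfl
    linarith [norm_le_norm_add_norm_sub' ((o.elim f fun k => (x' k : C(X, ℂ)) : C(X, ℂ))
      (Φ^[n] z₀)) ((t o : C(X, ℂ)) z₀)]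
  have h2 : ‖(t (some k) : C(X, ℂ)) z₀‖ = R := by
    simp [t, Algebra.algebraMap_eq_smul_one, abs_of_nonneg hR0]
  have h3 := hx' (some k) z₀ rfl
  simp only [Option.elim_some] at h3
  have h4 := norm_le_norm_add_norm_sub ((x' k : C(X, ℂ)) (Φ^[n] z₀)) ((t (some k) : C(X, ℂ)) z₀)
  have h5 := Finset.sum_le_card_nsmul T _ _ h1
  rw [nsmul_eq_mul] at h5
  have h6 := mul_le_mul_of_nonneg_left h5 (Nat.cast_nonneg (α := ℝ) N)
  linarith

theorem linearIndependent_of_forall_exists_mul_sum_lt {v : Option ℕ → C(X, ℂ)}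
    (h0 : v none ≠ 0)
    (h : ∀ (T : Finset (Option ℕ)) (k : ℕ), some k ∉ T → ∀ N : ℕ,
      ∃ z, N * ∑ o ∈ T, ‖v o z‖ < ‖v (some k) z‖) :
    LinearIndependent ℂ v := by
  classical
  rw [linearIndependent_iff']
  intro s a hs
  have hsome : ∀ k, some k ∈ s → a (some k) = 0 := by
    intro k hk
    by_contra hak
    have hak' : 0 < ‖a (some k)‖ := norm_pos_iff.2 hak
    set T := s.erase (some k)
    set C := ∑ o ∈ T, ‖a o‖
    obtain ⟨N, hN⟩ := exists_nat_ge (C / ‖a (some k)‖)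
    obtain ⟨z, hz⟩ := h T k (Finset.notMem_erase _ _) N
    have hsz : a (some k) * v (some k) z + ∑ o ∈ T, a o * v o z = 0 := by
      have := congrArg (fun g : C(X, ℂ) => g z) hs
      simp only [ContinuousMap.sum_apply, ContinuousMap.smul_apply, smul_eq_mul,
        ContinuousMap.zero_apply] at this
      rwa [← Finset.add_sum_erase s _ hk] at this
    have h1 : ‖a (some k)‖ * ‖v (some k) z‖ ≤ C * ∑ o ∈ T, ‖v o z‖ := by
      rw [← norm_mul, eq_neg_of_add_eq_zero_left hsz, norm_neg, Finset.mul_sum]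
      refine (norm_sum_le _ _).trans (Finset.sum_le_sum fun o ho => ?_)
      rw [norm_mul]
      gcongr
      exact Finset.single_le_sum (f := fun o => ‖a o‖) (fun _ _ => norm_nonneg _) ho
    have h2 : C ≤ N * ‖a (some k)‖ := (div_le_iff₀ hak').1 hN
    have hS : 0 ≤ ∑ o ∈ T, ‖v o z‖ := Finset.sum_nonneg fun _ _ => norm_nonneg _
    nlinarith [mul_le_mul_of_nonneg_right h2 hS]
  rintro (_ | k) hk
  · rw [Finset.sum_eq_single_of_mem none hk] at hs
    · exact (smul_eq_zero.1 hs).resolve_right h0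
    · rintro (_ | k) hk' hne
      · exact (hne rfl).elim
      · simp [hsome k hk']
  · exact hsome k hk

/-- If `f` has dense orbit in the closed algebra `A`, then a generic sequence in `A` together with
`f` is dense, linearly independent, and all its finite products have dense orbit. -/
theorem HasDenseOrbitIn.exists_family [T2Space X] [LocallyCompactSpace X]
    [SecondCountableTopology X] [Nonempty X] (hA : IsClosed (A : Set C(X, ℂ)))
    (hf : HasDenseOrbitIn A Φ f) (hfA : f ∈ A) (hΦ : ∀ g ∈ A, g.comp Φ ∈ A) :
    ∃ v : Option ℕ → C(X, ℂ), v none = f ∧ (∀ o, v o ∈ A) ∧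
      (∀ g ∈ A, ∀ K : Set X, IsCompact K → ∀ ε : ℝ, 0 < ε →
        ∃ o, ∀ z ∈ K, dist (v o z) (g z) < ε) ∧
      (∀ T : Finset (Option ℕ), T.Nonempty → HasDenseOrbitIn A Φ (∏ o ∈ T, v o)) ∧
      LinearIndependent ℂ v := by
  have : CompleteSpace A := hA.completeSpace_coe
  have : (uniformity A).IsCountablyGenerated := by
    rw [uniformity_subtype]
    infer_instance
  have hbase := TopologicalSpace.isBasis_countableBasis C(X, ℂ)
  have hcount := TopologicalSpace.countable_countableBasis C(X, ℂ)
  have hdense : ∀ᶠ x in residual (ℕ → A), ∀ B ∈ TopologicalSpace.countableBasis C(X, ℂ),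
      (B ∩ A).Nonempty → ∃ k, (x k : C(X, ℂ)) ∈ B := by
    refine (eventually_countable_ball hcount).2 fun B hB => eventually_imp_distrib_left.2 ?_
    rintro ⟨b, hb, hbA⟩
    refine residual_of_dense_open ?_ (dense_exists_apply_mem (B := Subtype.val ⁻¹' B)
      ⟨⟨b, hbA⟩, hb⟩)
    rw [ofPred_exists]
    exact isOpen_iUnion fun k =>
      (hbase.isOpen hB).preimage (continuous_subtype_val.comp (continuous_apply k))
  have hprod : ∀ᶠ x in residual (ℕ → A), ∀ B ∈ TopologicalSpace.countableBasis C(X, ℂ),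
      ∀ T : Finset (Option ℕ), T.Nonempty ∧ (B ∩ A).Nonempty →
      ∃ n : ℕ, (∏ o ∈ T, (o.elim f fun k => (x k : C(X, ℂ)) : C(X, ℂ))).comp
        ⟨Φ^[n], Φ.continuous.iterate n⟩ ∈ B := by
    refine (eventually_countable_ball hcount).2 fun B hB => eventually_countable_forall.2
      fun T => eventually_imp_distrib_left.2 ?_
    rintro ⟨hT, hBA⟩
    refine residual_of_dense_open ?_ (hf.dense_exists_prod_comp_mem hfA hΦ hT (hbase.isOpen hB) hBA)
    rw [ofPred_exists]
    exact isOpen_iUnion fun n => (hbase.isOpen hB).preimage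
      ((ContinuousMap.continuous_precomp _).comp
        (continuous_finsetProd _ fun o _ => continuous_elim_coe f o))
  have hlin : ∀ᶠ x in residual (ℕ → A), ∀ (T : Finset (Option ℕ)) (k N : ℕ), some k ∉ T →
      ∃ z : X, N * ∑ o ∈ T, ‖(o.elim f fun k => (x k : C(X, ℂ)) : C(X, ℂ)) z‖
        < ‖(x k : C(X, ℂ)) z‖ := by
    refine eventually_countable_forall.2 fun T => eventually_countable_forall.2 fun k =>
      eventually_countable_forall.2 fun N => eventually_imp_distrib_left.2 fun hk => ?_
    refine residual_of_dense_open ?_ (hf.dense_exists_mul_sum_lt hfA hΦ hk N)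
    rw [ofPred_exists]
    have heval : ∀ (o : Option ℕ) (z : X), Continuous fun x : ℕ → A =>
        ‖(o.elim f fun k => (x k : C(X, ℂ)) : C(X, ℂ)) z‖ := fun o z =>
      ((continuous_eval_const z).comp (continuous_elim_coe f o)).norm
    exact isOpen_iUnion fun z => isOpen_lt
      (continuous_const.mul (continuous_finsetSum _ fun o _ => heval o z)) (heval (some k) z)
  obtain ⟨x, hx1, hx2, hx3⟩ :=
    (dense_of_mem_residual (hdense.and (hprod.and hlin))).nonempty
  have hball : ∀ g ∈ A, ∀ K : Set X, IsCompact K → ∀ ε : ℝ, 0 < ε →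
      ∃ B ∈ TopologicalSpace.countableBasis C(X, ℂ), (B ∩ A).Nonempty ∧
        ∀ g' ∈ B, ∀ z ∈ K, dist (g' z) (g z) < ε := by
    intro g hg K hK ε hε
    obtain ⟨B, hB, hgB, hBs⟩ := hbase.mem_nhds_iff.1
      ((ContinuousMap.nhds_basis_dist_lt g).mem_of_mem (i := (K, ε)) ⟨hK, hε⟩)
    exact ⟨B, hB, ⟨g, hgB, hg⟩, hBs⟩
  have hf0 : f ≠ 0 := by
    rintro rfl
    obtain ⟨z₀⟩ := ‹Nonempty X›
    obtain ⟨n, hn⟩ := hf 1 A.one_mem {z₀} isCompact_singleton 1 one_pos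
    simpa using hn z₀ rfl
  refine ⟨fun o => o.elim f fun k => (x k : C(X, ℂ)), rfl, ?_, fun g hg K hK ε hε => ?_,
    fun T hT g hg K hK ε hε => ?_,
    linearIndependent_of_forall_exists_mul_sum_lt hf0 fun T k hk N => hx3 T k N hk⟩
  · rintro (_ | k)
    exacts [hfA, (x k).2]
  · obtain ⟨B, hB, hBA, hBs⟩ := hball g hg K hK ε hε
    obtain ⟨k, hk⟩ := hx1 B hB hBA
    exact ⟨some k, hBs _ hk⟩
  · obtain ⟨B, hB, hBA, hBs⟩ := hball g hg K hK ε hε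
    obtain ⟨n, hn⟩ := hx2 B hB T ⟨hT, hBA⟩
    exact ⟨n, hBs _ hn⟩

end Abstract

/-- The algebra of holomorphic functions on `G`, as functions on the subtype `G`. -/
def holomorphicSubalgebra (G : Set ℂ) : Subalgebra ℂ C(G, ℂ) where
  carrier := {g | ∃ g' : ℂ → ℂ, DifferentiableOn ℂ g' G ∧ ∀ z : G, g z = g' z}
  mul_mem' := by
    rintro a b ⟨a', ha, ha'⟩ ⟨b', hb, hb'⟩
    exact ⟨a' * b', ha.mul hb, fun z => by simp [ha', hb']⟩
  add_mem' := by
    rintro a b ⟨a', ha, ha'⟩ ⟨b', hb, hb'⟩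
    exact ⟨a' + b', ha.add hb, fun z => by simp [ha', hb']⟩
  algebraMap_mem' c :=
    ⟨fun _ => c, differentiableOn_const c, fun z => by simp [Algebra.algebraMap_eq_smul_one]⟩

theorem isClosed_holomorphicSubalgebra {G : Set ℂ} (hG : IsOpen G) :
    IsClosed (holomorphicSubalgebra G : Set C(G, ℂ)) := by
  have : LocallyCompactSpace G := hG.locallyCompactSpace
  refine isClosed_of_closure_subset fun g hg => ?_
  have hext : ∀ (h : C(G, ℂ)) (z : G), Function.extend Subtype.val h 0 (z : ℂ) = h z :=
    fun h z => Subtype.val_injective.extend_apply _ _ _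
  rw [mem_closure_iff_clusterPt, ClusterPt] at hg
  have ht : TendstoLocallyUniformly (fun (h : C(G, ℂ)) z => h z) g
      (𝓝 g ⊓ 𝓟 (holomorphicSubalgebra G : Set C(G, ℂ))) :=
    ContinuousMap.tendsto_iff_tendstoLocallyUniformly.1 (tendsto_id.mono_left inf_le_left)
  refine ⟨Function.extend Subtype.val g 0, ?_, fun z => (hext g z).symm⟩
  refine TendstoLocallyUniformlyOn.differentiableOn
    (F := fun (h : C(G, ℂ)) => Function.extend Subtype.val h 0)
    (φ := 𝓝 g ⊓ 𝓟 (holomorphicSubalgebra G : Set C(G, ℂ))) ?_ ?_ hG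
  · rw [tendstoLocallyUniformlyOn_iff_tendstoLocallyUniformly_comp_coe]
    convert ht using 1
    · ext h z; exact hext _ z
    · ext z; exact hext _ z
  · filter_upwards [mem_inf_of_right (mem_principal_self _)]
    rintro h ⟨h', hd, he⟩
    exact hd.congr fun z hz => (hext h ⟨z, hz⟩).trans (he ⟨z, hz⟩)

/-- Let `G ⊆ ℂ` be a simply connected domain (nonempty, open, connected, with
connected complement in the Riemann sphere `ℂ∞ = OnePoint ℂ`), and let `φ` be a
holomorphic automorphism of `G` without fixed points.  Then for every
`f ∈ HC(C_φ)` there is a family `F ⊆ H(G)` with: (a) `f ∈ F ⊆ HC(C_φ)`;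
(b) `F` is dense in `H(G)`; (c) every product of finitely many distinct members
of `F` is in `HC(C_φ)`; (d) `F` is linearly independent (as functions on `G`). -/
theorem exists_dense_product_stable_hypercyclic_family_for_composition
    (G : Set ℂ) (hGopen : IsOpen G) (hGconn : IsConnected G)
    (hGsc : IsConnected (((fun z : ℂ => (z : OnePoint ℂ)) '' G)ᶜ))
    (φ : ℂ → ℂ) (hφdiff : DifferentiableOn ℂ φ G)
    (hφbij : Set.BijOn φ G G)
    (hφfix : ∀ z ∈ G, φ z ≠ z)
    (f : ℂ → ℂ) (hf : DifferentiableOn ℂ f G)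
    (hfHC : HypercyclicForComp G φ f) :
    ∃ F : Set (ℂ → ℂ),
      (∀ h ∈ F, DifferentiableOn ℂ h G) ∧
      f ∈ F ∧
      (∀ h ∈ F, HypercyclicForComp G φ h) ∧
      (∀ g : ℂ → ℂ, DifferentiableOn ℂ g G →
        ∀ K : Set ℂ, K ⊆ G → IsCompact K →
          ∀ ε : ℝ, 0 < ε → ∃ h ∈ F, ∀ z ∈ K, dist (h z) (g z) < ε) ∧
      (∀ F₀ : Finset (ℂ → ℂ), ↑F₀ ⊆ F → F₀.Nonempty →
        HypercyclicForComp G φ (fun z => ∏ h ∈ F₀, h z)) ∧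
      LinearIndependent ℂ (fun h : F => G.restrict (h : ℂ → ℂ)) := by
  classical
  have : LocallyCompactSpace G := hGopen.locallyCompactSpace
  have : Nonempty G := hGconn.nonempty.to_subtype
  set A := holomorphicSubalgebra G
  have toC : ∀ g : ℂ → ℂ, DifferentiableOn ℂ g G → ∃ g' ∈ A, ∀ z : G, g' z = g z := fun g hg =>
    ⟨⟨G.domRestrict g, hg.continuousOn.domRestrict⟩, ⟨g, hg, fun _ => rfl⟩, fun _ => rfl⟩
  let Φ : C(G, G) := ⟨hφbij.mapsTo.restrict, hφdiff.continuousOn.mapsToRestrict hφbij.mapsTo⟩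
  have hΦn : ∀ (n : ℕ) (z : G), ((Φ^[n] z : G) : ℂ) = φ^[n] z := by
    intro n
    induction n with
    | zero => exact fun z => rfl
    | succ n ih => exact fun z => by rw [Function.iterate_succ_apply, ih]; rfl
  have hΦA : ∀ g ∈ A, g.comp Φ ∈ A := by
    rintro g ⟨g', hg', h⟩
    exact ⟨g' ∘ φ, hg'.comp hφdiff hφbij.mapsTo, fun z => h (Φ z)⟩
  have hiff : ∀ (g : ℂ → ℂ) (g' : C(G, ℂ)), (∀ z : G, g' z = g z) →
      (HasDenseOrbitIn A Φ g' ↔ HypercyclicForComp G φ g) := by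
    intro g g' hg
    constructor
    · intro H h hh K hKG hK ε hε
      obtain ⟨h', hh'A, hh'⟩ := toC h hh
      obtain ⟨n, hn⟩ := H h' hh'A (Subtype.val ⁻¹' K)
        (Topology.IsInducing.subtypeVal.isCompact_preimage' hK (by simpa using hKG)) ε hε
      exact ⟨n, fun z hz => by simpa [hg, hh', hΦn] using hn ⟨z, hKG hz⟩ hz⟩
    · rintro H h ⟨h', hh', hh'e⟩ K hK ε hε
      obtain ⟨n, hn⟩ := H h' hh' (Subtype.val '' K) (by rintro _ ⟨z, _, rfl⟩; exact z.2)
        (hK.image continuous_subtype_val) ε hε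
      exact ⟨n, fun z hz => by simpa [hg, hh'e, hΦn] using hn z ⟨z, hz, rfl⟩⟩
  obtain ⟨f', hf'A, hf'⟩ := toC f hf
  obtain ⟨v, hv0, hvA, hvd, hvp, hvl⟩ := HasDenseOrbitIn.exists_family
    (isClosed_holomorphicSubalgebra hGopen) ((hiff f f' hf').2 hfHC) hf'A hΦA
  have hy : ∀ o, ∃ y : ℂ → ℂ, DifferentiableOn ℂ y G ∧ (∀ z : G, v o z = y z) ∧
      (o = none → y = f) := by
    rintro (_ | k)
    · exact ⟨f, hf, fun z => by rw [hv0, hf'], fun _ => rfl⟩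
    · obtain ⟨y, hy, hy'⟩ := hvA (some k)
      exact ⟨y, hy, hy', by simp⟩
  choose y hyd hyv hy0 using hy
  have hyl : LinearIndependent ℂ fun o => G.domRestrict (y o) := by
    have := hvl.map' (ContinuousMap.coeFnLinearMap ℂ)
      (LinearMap.ker_eq_bot.2 DFunLike.coe_injective)
    have e : (fun o => G.domRestrict (y o)) = ContinuousMap.coeFnLinearMap ℂ ∘ v := by
      ext o z
      exact (hyv o z).symm
    rw [e]
    exact this
  have hyi : Function.Injective y := fun o o' h => hyl.injective (by simp [h])
  have hprod : ∀ F₀ : Finset (ℂ → ℂ), ↑F₀ ⊆ Set.range y → F₀.Nonempty →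
      HypercyclicForComp G φ (fun z => ∏ h ∈ F₀, h z) := by
    intro F₀ hF₀ hne
    obtain ⟨T, rfl⟩ : ∃ T : Finset (Option ℕ), T.image y = F₀ := by
      obtain ⟨T, -, hT⟩ := Finset.subset_set_image_iff.1 (image_univ.symm ▸ hF₀)
      exact ⟨T, hT⟩
    refine (hiff _ (∏ o ∈ T, v o) fun z => ?_).1 (hvp T (by simpa using hne))
    rw [Finset.prod_image hyi.injOn, ContinuousMap.prod_apply]
    exact Finset.prod_congr rfl fun o _ => hyv o z
  refine ⟨Set.range y, ?_, ⟨none, hy0 none rfl⟩, fun h hh => ?_, fun g hg K hKG hK ε hε => ?_,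
    hprod, ?_⟩
  · rintro _ ⟨o, rfl⟩
    exact hyd o
  · simpa using hprod {h} (by simpa using hh) (Finset.singleton_nonempty h)
  · obtain ⟨g', hg'A, hg'⟩ := toC g hg
    obtain ⟨o, ho⟩ := hvd g' hg'A (Subtype.val ⁻¹' K)
        (Topology.IsInducing.subtypeVal.isCompact_preimage' hK (by simpa using hKG)) ε hε
    exact ⟨y o, ⟨o, rfl⟩, fun z hz => by simpa [hyv, hg'] using ho ⟨z, hKG hz⟩ hz⟩
  · rw [← linearIndependent_equiv (Equiv.ofInjective y hyi)]
    exact hyl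
end
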